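/- Consider the shift action of ℤ on the Hilbert cube [0,1]^ℤ. For n ≥ 1 let F_n ⊂ [0,1/n]^ℤ be the set of n-periodic points (fixed points of the nℤ-subaction on [0,1/n]^ℤ), and set X := ∪_{n≥1} F_n (closure taken in [0,1]^ℤ if needed; X is ℤ-invariant and closed). Let X_n be the set of fixed points of the nℤ-action on X. Then F_n ⊂ X_n and dim X_n = n for each n ≥ 1, so resdim(X : {nℤ}) := liminf_n dim X_n / n = 1. -/

import Mathlib

open Filter
open scoped ENNReal

def CovDimLE (Y : Type) [TopologicalSpace Y] (n : ℕ) : Prop :=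
  ∀ (ι : Type) (U : ι → Set Y), (∀ i, IsOpen (U i)) → (⋃ i, U i) = Set.univ →
    ∃ (κ : Type) (W : κ → Set Y), (∀ k, IsOpen (W k)) ∧ (⋃ k, W k) = Set.univ ∧
      (∀ k, ∃ i, W k ⊆ U i) ∧
      ∀ (y : Y) (s : Finset κ), (∀ k ∈ s, y ∈ W k) → s.card ≤ n + 1

/-- Lebesgue covering dimension. -/
noncomputable def covDim (Y : Type) [TopologicalSpace Y] : ℕ :=
  sInf {n | CovDimLE Y n}

/-- `F_n ⊆ [0,1/n]^ℤ`: the `n`-periodic points of the small cube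
`[0,1/n]^ℤ` (fixed points of the `nℤ`-subaction of the shift). -/
def Fset (n : ℕ) : Set (ℤ → ℝ) :=
  {x | (∀ m : ℤ, x m ∈ Set.Icc (0 : ℝ) (1 / n)) ∧ ∀ m : ℤ, x (m + n) = x m}

/-- `X = ⋃_{n≥1} F_n ⊆ [0,1]^ℤ` (a shift-invariant closed subset). -/
def Xset : Set (ℤ → ℝ) := ⋃ n ∈ {n : ℕ | 1 ≤ n}, Fset n

/-- `X_n`: the fixed points of the `nℤ`-action on `X`. -/
def XnSet (n : ℕ) : Set (ℤ → ℝ) := {x ∈ Xset | ∀ m : ℤ, x (m + n) = x m}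

namespace KuhnGrid

variable {n : ℕ}

/-- The `k`-th vertex of the Kuhn simplex in the unit cube with lowest corner `v` that raises
the coordinates in the order given by `τ`. -/
def vertex (v : Fin n → ℤ) (τ : Equiv.Perm (Fin n)) (k : Fin (n + 1)) : Fin n → ℤ :=
  fun i => v i + if (τ i : ℕ) < k then 1 else 0

/-- The lowest corners of the unit cubes of the grid `{0, …, N}ⁿ`. -/
noncomputable def corners (n N : ℕ) : Finset (Fin n → ℤ) :=
  Fintype.piFinset fun _ => Finset.Ico (0 : ℤ) N

/-- The matrix with rows `(1, G₁ (p k), …, Gₙ (p k))`. -/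
def affineMatrix (G : Fin n → (Fin n → ℤ) → ℝ) {m : ℕ} (p : Fin m → Fin n → ℤ) :
    Matrix (Fin m) (Fin (n + 1)) ℝ :=
  Matrix.of fun k => Fin.cons 1 fun i => G i (p k)

/-- The signed sum over all Kuhn simplices of the grid of the volumes of their images
under `G`. -/
noncomputable def volumeSum (N : ℕ) (G : Fin n → (Fin n → ℤ) → ℝ) : ℝ :=
  ∑ v ∈ corners n N, ∑ τ : Equiv.Perm (Fin n),
    ((Equiv.Perm.sign τ : ℤ) : ℝ) * (affineMatrix G (vertex v τ)).det

theorem sum_shift_eq (N : ℕ) (a : Fin n) (f : (Fin n → ℤ) → ℝ)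
    (h0 : ∀ v : Fin n → ℤ, v a = 0 → f v = 0) (hN : ∀ v : Fin n → ℤ, v a = (N : ℤ) → f v = 0) :
    ∑ v ∈ corners n N, f (v + Pi.single a 1) = ∑ v ∈ corners n N, f v := by
  refine Finset.sum_bij_ne_zero (fun v _ _ => v + Pi.single a 1) ?_ ?_ ?_ ?_
  · intro v hv hne
    have hv' : ∀ i, 0 ≤ v i ∧ v i < N := by simpa [corners] using hv
    have : v a + 1 ≠ N := fun h => hne (hN _ (by simpa using h))
    simp only [corners, Fintype.mem_piFinset, Finset.mem_Ico]
    intro i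
    have := hv' i
    by_cases hi : i = a
    · subst hi; simp; omega
    · simpa [hi] using this
  · intro v _ _ w _ _ h
    simpa using h
  · intro w hw hne
    have hw' : ∀ i, 0 ≤ w i ∧ w i < N := by simpa [corners] using hw
    have : w a ≠ 0 := fun h => hne (h0 _ h)
    refine ⟨w - Pi.single a 1, ?_, by simpa using hne, by simp⟩
    simp only [corners, Fintype.mem_piFinset, Finset.mem_Ico]
    intro i
    have := hw' i
    by_cases hi : i = a
    · subst hi; simp; omega
    · simpa [hi] using this
  · intros; rfl

theorem sum_inner_facets_eq_zero {n : ℕ} (v : Fin n → ℤ) (ψ : (Fin n → Fin n → ℤ) → ℝ)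
    (k : Fin (n + 1)) (h0 : k ≠ 0) (hl : k ≠ Fin.last n) :
    ∑ τ : Equiv.Perm (Fin n), ((Equiv.Perm.sign τ : ℤ) : ℝ) *
      ψ (fun j => vertex v τ (k.succAbove j)) = 0 := by
  have hk0 : 0 < (k : ℕ) := Nat.pos_of_ne_zero fun h => h0 (Fin.ext h)
  have hkn : (k : ℕ) < n := by
    have h1 := k.is_lt
    have h2 : (k : ℕ) ≠ n := fun h => hl (Fin.ext h)
    omega
  let a : Fin n := ⟨k - 1, by omega⟩
  let b : Fin n := ⟨k, hkn⟩
  have hab : a ≠ b := by simp only [a, b, ne_eq, Fin.mk.injEq]; omega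
  have hvert : ∀ τ : Equiv.Perm (Fin n), ∀ j,
      vertex v (Equiv.swap a b * τ) (k.succAbove j) = vertex v τ (k.succAbove j) := by
    intro τ j
    have hne : ((k.succAbove j : Fin (n + 1)) : ℕ) ≠ k := fun h =>
      Fin.succAbove_ne k j (Fin.ext h)
    ext i
    have hτ : (Equiv.swap a b * τ) i = Equiv.swap a b (τ i) := rfl
    simp only [vertex, hτ]
    rcases eq_or_ne (τ i) a with h | h
    · simp only [h, Equiv.swap_apply_left, a, b]
      split_ifs <;> omega
    rcases eq_or_ne (τ i) b with h' | h'
    · simp only [h', Equiv.swap_apply_right, a, b]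
      split_ifs <;> omega
    rw [Equiv.swap_apply_of_ne_of_ne h h']
  refine Finset.sum_involution (fun τ _ => Equiv.swap a b * τ) ?_ ?_ ?_ ?_
  · intro τ _
    simp [hvert, Equiv.Perm.sign_swap hab]
  · intro τ _ _ h
    exact hab (Equiv.swap_eq_one_iff.1 (mul_eq_right.1 h))
  · intros; exact Finset.mem_univ _
  · intro τ _
    simp [← mul_assoc]

theorem sum_first_facets_eq {m : ℕ} (N : ℕ) (ψ : (Fin (m + 1) → Fin (m + 1) → ℤ) → ℝ)
    (hψ : ∀ q a, (∀ j, q j a = 0) ∨ (∀ j, q j a = (N : ℤ)) → ψ q = 0) :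
    ∑ v ∈ corners (m + 1) N, ∑ τ : Equiv.Perm (Fin (m + 1)),
      ((Equiv.Perm.sign τ : ℤ) : ℝ) * ψ (fun j => vertex v τ j.succ) =
    (-1) ^ m * ∑ v ∈ corners (m + 1) N, ∑ τ : Equiv.Perm (Fin (m + 1)),
      ((Equiv.Perm.sign τ : ℤ) : ℝ) * ψ (fun j => vertex v τ j.castSucc) := by
  have hrot : ∀ (v : Fin (m + 1) → ℤ) (τ : Equiv.Perm (Fin (m + 1))) (j : Fin (m + 1)),
      vertex v (finRotate (m + 1) * τ) j.succ =
        vertex (v + Pi.single (τ.symm (Fin.last m)) 1) τ j.castSucc := by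
    intro v τ j
    ext i
    have hj := j.is_lt
    have hi := (τ i).is_lt
    have hτ : (finRotate (m + 1) * τ) i = finRotate (m + 1) (τ i) := rfl
    simp only [vertex, hτ, Pi.add_apply, Fin.val_succ, Fin.val_castSucc, coe_finRotate]
    rcases eq_or_ne (τ i) (Fin.last m) with h | h
    · have h' : i = τ.symm (Fin.last m) := by simp [← h]
      simp [h, ← h']
      omega
    · have h' : i ≠ τ.symm (Fin.last m) := fun e => h (by simp [e])
      simp [h, h']
  rw [Finset.sum_comm, Finset.sum_comm (s := corners (m + 1) N), Finset.mul_sum,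
    ← Equiv.sum_comp (Equiv.mulLeft (finRotate (m + 1)))]
  refine Finset.sum_congr rfl fun τ _ => ?_
  simp only [Equiv.coe_mulLeft, hrot, ← Finset.mul_sum]
  rw [sum_shift_eq N (τ.symm (Fin.last m)) (fun v => ψ fun j => vertex v τ j.castSucc)]
  · simp [sign_finRotate, mul_assoc]
  · intro v hv
    refine hψ _ (τ.symm (Fin.last m)) (Or.inl fun j => ?_)
    simp [vertex, hv, Fin.is_le]
  · intro v hv
    refine hψ _ (τ.symm (Fin.last m)) (Or.inr fun j => ?_)
    simp [vertex, hv, Fin.is_le]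

theorem sum_facets_eq_zero {m : ℕ} (N : ℕ) (ψ : (Fin (m + 1) → Fin (m + 1) → ℤ) → ℝ)
    (hψ : ∀ q a, (∀ j, q j a = 0) ∨ (∀ j, q j a = (N : ℤ)) → ψ q = 0) :
    ∑ v ∈ corners (m + 1) N, ∑ τ : Equiv.Perm (Fin (m + 1)), ((Equiv.Perm.sign τ : ℤ) : ℝ) *
      ∑ k : Fin (m + 2), (-1) ^ (k : ℕ) * ψ (fun j => vertex v τ (k.succAbove j)) = 0 := by
  have hmid : ∀ (v : Fin (m + 1) → ℤ) (k : Fin m), ∑ τ : Equiv.Perm (Fin (m + 1)),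
      ((Equiv.Perm.sign τ : ℤ) : ℝ) *
        ((-1) ^ (k.succ.castSucc : ℕ) * ψ (fun j => vertex v τ (k.succ.castSucc.succAbove j)))
        = 0 := by
    intro v k
    simp_rw [mul_left_comm _ ((-1 : ℝ) ^ _)]
    rw [← Finset.mul_sum, sum_inner_facets_eq_zero, mul_zero]
    · exact fun h => Fin.succ_ne_zero k (Fin.ext (by simpa using congrArg Fin.val h))
    · exact (Fin.castSucc_lt_last _).ne
  have key := sum_first_facets_eq N ψ hψ
  simp only [Fin.sum_univ_castSucc (n := m + 1), Fin.sum_univ_succ (n := m), mul_add,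
    Finset.mul_sum, Finset.sum_add_distrib]
  rw [Finset.sum_congr rfl fun v _ => Finset.sum_comm (s := Finset.univ) (t := Finset.univ)
    (f := fun (τ : Equiv.Perm (Fin (m + 1))) (k : Fin m) => ((Equiv.Perm.sign τ : ℤ) : ℝ) *
        ((-1) ^ (k.succ.castSucc : ℕ) * ψ (fun j => vertex v τ (k.succ.castSucc.succAbove j))))]
  simp only [hmid, Finset.sum_const_zero, add_zero]
  simp only [Fin.castSucc_zero, Fin.val_zero, pow_zero, one_mul, Fin.zero_succAbove, key,
    Fin.val_last, Fin.succAbove_last, mul_left_comm _ ((-1 : ℝ) ^ (m + 1)), ← Finset.mul_sum]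
  ring

theorem affineMatrix_update (G : Fin n → (Fin n → ℤ) → ℝ) (i : Fin n) (f : (Fin n → ℤ) → ℝ)
    {m : ℕ} (p : Fin m → Fin n → ℤ) :
    affineMatrix (Function.update G i f) p =
      (affineMatrix G p).updateCol i.succ (fun k => f (p k)) := by
  ext k r
  refine Fin.cases ?_ (fun j => ?_) r
  · simp [affineMatrix, (Fin.succ_ne_zero i).symm]
  · rcases eq_or_ne j i with rfl | h
    · simp [affineMatrix]
    · simp [affineMatrix, h]

theorem volumeSum_update_sub (N : ℕ) (G : Fin n → (Fin n → ℤ) → ℝ) (i : Fin n)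
    (f g : (Fin n → ℤ) → ℝ) :
    volumeSum N (Function.update G i f) =
      volumeSum N (Function.update G i g) + volumeSum N (Function.update G i (f - g)) := by
  simp only [volumeSum, ← Finset.sum_add_distrib, ← mul_add, affineMatrix_update]
  refine Finset.sum_congr rfl fun v _ => Finset.sum_congr rfl fun τ _ => ?_
  rw [← Matrix.det_updateCol_add]
  congr 3
  ext k
  simp

theorem det_affineMatrix_update {m : ℕ} (G : Fin (m + 1) → (Fin (m + 1) → ℤ) → ℝ)
    (i : Fin (m + 1)) (h : (Fin (m + 1) → ℤ) → ℝ) (p : Fin (m + 2) → Fin (m + 1) → ℤ) :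
    (affineMatrix (Function.update G i h) p).det =
      (-1) ^ (i : ℕ) * ∑ k : Fin (m + 2), (-1) ^ (k : ℕ) *
        ((∑ j, h (p (k.succAbove j))) * ((affineMatrix G fun j => p (k.succAbove j)).submatrix id
          i.succ.succAbove).det) := by
  have expand : ∀ u : Fin (m + 2) → ℝ, ((affineMatrix G p).updateCol i.succ u).det =
      (-1) ^ ((i : ℕ) + 1) * ∑ k : Fin (m + 2), (-1) ^ (k : ℕ) *
        (u k * ((affineMatrix G fun j => p (k.succAbove j)).submatrix id
          i.succ.succAbove).det) := by
    intro u
    rw [Matrix.det_succ_column _ i.succ, Finset.mul_sum]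
    refine Finset.sum_congr rfl fun k _ => ?_
    rw [Matrix.submatrix_updateCol_succAbove, Matrix.updateCol_self, Fin.val_succ, pow_add]
    have : (affineMatrix G p).submatrix k.succAbove i.succ.succAbove =
        (affineMatrix G fun j => p (k.succAbove j)).submatrix id i.succ.succAbove := rfl
    rw [this]
    ring
  have hone : ((affineMatrix G p).updateCol i.succ
      (fun _ => ∑ k, h (p k))).det = 0 := by
    have : (fun _ : Fin (m + 2) => ∑ k, h (p k)) =
        (∑ k, h (p k)) • (fun k => affineMatrix G p k 0) := by
      ext k; simp [affineMatrix]
    rw [this, Matrix.det_updateCol_smul,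
      Matrix.det_updateCol_eq_zero (Fin.succ_ne_zero i).symm, mul_zero]
  rw [affineMatrix_update, expand]
  rw [expand] at hone
  rw [← sub_zero (_ * _), ← hone, ← mul_sub, ← Finset.sum_sub_distrib, pow_succ, mul_assoc,
    neg_one_mul, ← Finset.sum_neg_distrib]
  congr 1
  refine Finset.sum_congr rfl fun k _ => ?_
  rw [Fin.sum_univ_succAbove _ k]
  ring

theorem volumeSum_update_eq_zero (N : ℕ) (G : Fin n → (Fin n → ℤ) → ℝ)
    (i : Fin n) (h : (Fin n → ℤ) → ℝ)
    (hG0 : ∀ i p, p i = 0 → G i p = 0) (hGN : ∀ i p, p i = (N : ℤ) → G i p = N)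
    (h0 : ∀ p : Fin n → ℤ, p i = 0 → h p = 0)
    (hN : ∀ p : Fin n → ℤ, p i = (N : ℤ) → h p = 0) :
    volumeSum N (Function.update G i h) = 0 := by
  obtain _ | m := n
  · exact i.elim0
  have key := sum_facets_eq_zero N
    (fun q => (∑ j, h (q j)) * ((affineMatrix G q).submatrix id i.succ.succAbove).det) ?_
  · simp only [volumeSum, det_affineMatrix_update]
    simp only [mul_left_comm _ ((-1 : ℝ) ^ (i : ℕ)), ← Finset.mul_sum]
    exact mul_eq_zero_of_right _ key
  · intro q a hq
    rcases eq_or_ne a i with rfl | hai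
    · have : ∀ j, h (q j) = 0 := fun j =>
        hq.elim (fun hq => h0 _ (hq j)) (fun hq => hN _ (hq j))
      simp [this]
    · obtain ⟨c, hc⟩ : ∃ c, ∀ j, G a (q j) = c :=
        hq.elim (fun hq => ⟨0, fun j => hG0 _ _ (hq j)⟩) (fun hq => ⟨N, fun j => hGN _ _ (hq j)⟩)
      obtain ⟨r, hr⟩ := Fin.exists_succAbove_eq (Fin.succ_ne_zero i).symm
      obtain ⟨s, hs⟩ := Fin.exists_succAbove_eq ((Fin.succ_injective _).ne hai)
      have hrs : r ≠ s := fun e => Fin.succ_ne_zero a (by rw [← hs, ← hr, e])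
      set A := (affineMatrix G q).submatrix id i.succ.succAbove with hA
      have hcol : A = A.updateCol s (c • fun k => A k r) := by
        ext k t
        rcases eq_or_ne t s with rfl | ht
        · simp [hA, hr, hs, affineMatrix, hc]
        · simp [ht]
      rw [hcol, Matrix.det_updateCol_smul, Matrix.det_updateCol_eq_zero hrs]
      simp

theorem volumeSum_eq_of_boundary (N : ℕ) (G G' : Fin n → (Fin n → ℤ) → ℝ)
    (hG0 : ∀ i p, p i = 0 → G i p = 0) (hGN : ∀ i p, p i = (N : ℤ) → G i p = N)
    (hG0' : ∀ i p, p i = 0 → G' i p = 0) (hGN' : ∀ i p, p i = (N : ℤ) → G' i p = N) :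
    volumeSum N G = volumeSum N G' := by
  have key : ∀ s : Finset (Fin n), volumeSum N (s.piecewise G' G) = volumeSum N G := by
    intro s
    induction s using Finset.induction_on with
    | empty => simp
    | insert i s hi ih =>
      have hzero : volumeSum N (Function.update (s.piecewise G' G) i (G' i - G i)) = 0 := by
        refine volumeSum_update_eq_zero N _ i _ ?_ ?_ ?_ ?_
        · intro j p hp
          by_cases hj : j ∈ s <;> simp [hj, hG0 j p hp, hG0' j p hp]
        · intro j p hp
          by_cases hj : j ∈ s <;> simp [hj, hGN j p hp, hGN' j p hp]
        · intro p hp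
          simp [hG0 i p hp, hG0' i p hp]
        · intro p hp
          simp [hGN i p hp, hGN' i p hp]
      rw [Finset.piecewise_insert, volumeSum_update_sub (g := G i), hzero, add_zero, ← ih]
      congr 1
      rw [Function.update_eq_self_iff, Finset.piecewise_eq_of_notMem _ _ _ hi]
  rw [← key Finset.univ, Finset.piecewise_univ]

theorem det_affineMatrix_coord (v : Fin n → ℤ) (τ : Equiv.Perm (Fin n)) :
    (affineMatrix (fun i p => (p i : ℝ)) (vertex v τ)).det = ((Equiv.Perm.sign τ : ℤ) : ℝ) := by
  set A := affineMatrix (fun i p => (p i : ℝ)) (vertex v τ) with hA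
  let T : Matrix (Fin n) (Fin n) ℝ := Matrix.of fun j i => if i ≤ j then 1 else 0
  let B : Matrix (Fin (n + 1)) (Fin (n + 1)) ℝ :=
    Matrix.of fun k r => A k r - if k = 0 then 0 else A 0 r
  have hAB : A.det = B.det :=
    Matrix.det_eq_of_forall_row_eq_smul_add_const (fun k => if k = 0 then 0 else 1) 0 (by simp)
      (fun k r => by by_cases hk : k = 0 <;> simp [B, hk])
  have hBT : B.submatrix Fin.succ Fin.succ = T.submatrix id τ := by
    ext j i
    simp [B, T, hA, affineMatrix, vertex]
  have hT : T.det = 1 := by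
    rw [Matrix.det_of_isLowerTriangular]
    · simp [T]
    · intro i j hij
      have : i < j := hij
      simp [T, this]
  have hB0 : B 0 0 = 1 := by simp [B, hA, affineMatrix]
  have hBs : ∀ k : Fin n, B k.succ 0 = 0 := by simp [B, hA, affineMatrix]
  rw [hAB, Matrix.det_succ_column_zero, Fin.sum_univ_succ]
  simp only [hB0, hBs, mul_zero, zero_mul, Finset.sum_const_zero, add_zero]
  simp [Fin.succAbove_zero, hBT, Matrix.det_permute', hT]

theorem volumeSum_coord_ne_zero (n : ℕ) {N : ℕ} (hN : N ≠ 0) :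
    volumeSum N (fun (i : Fin n) p => (p i : ℝ)) ≠ 0 := by
  have hsq : ∀ τ : Equiv.Perm (Fin n),
      ((Equiv.Perm.sign τ : ℤ) : ℝ) * ((Equiv.Perm.sign τ : ℤ) : ℝ) = 1 := by
    intro τ
    rw [← Int.cast_mul, ← Units.val_mul, Int.units_mul_self]
    simp
  simp only [volumeSum, det_affineMatrix_coord, hsq]
  simp [corners, hN, Nat.factorial_ne_zero, Fintype.card_perm]

/-- A labelled form of Sperner's lemma for the Kuhn triangulation of a cubical grid. -/
theorem exists_simplex_injective {α : Type*} {N : ℕ} (hN : N ≠ 0) (label : (Fin n → ℤ) → α)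
    (A : Fin n → Set α) (h0 : ∀ i p, p i = 0 → label p ∈ A i)
    (h1 : ∀ i p, p i = (N : ℤ) → label p ∉ A i) :
    ∃ (v : Fin n → ℤ) (τ : Equiv.Perm (Fin n)),
      Function.Injective fun k => label (vertex v τ k) := by
  classical
  by_contra! hcon
  let G : Fin n → (Fin n → ℤ) → ℝ := fun i p => if label p ∈ A i then 0 else N
  refine volumeSum_coord_ne_zero n hN ?_
  rw [← volumeSum_eq_of_boundary N G _ (fun i p hp => by simp [G, h0 i p hp])
    (fun i p hp => by simp [G, h1 i p hp]) (fun i p hp => by simp [hp])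
    (fun i p hp => by simp [hp])]
  refine Finset.sum_eq_zero fun v _ => Finset.sum_eq_zero fun τ _ => ?_
  obtain ⟨k, l, hkl, hne⟩ : ∃ k l, label (vertex v τ k) = label (vertex v τ l) ∧ k ≠ l := by
    simpa [Function.Injective] using hcon v τ
  rw [Matrix.det_zero_of_row_eq hne, mul_zero]
  exact congrArg (fun a => (Fin.cons 1 fun i => if a ∈ A i then 0 else (N : ℝ) :
    Fin (n + 1) → ℝ)) hkl

end KuhnGrid

theorem le_of_covDimLE_of_cube {Y : Type} [TopologicalSpace Y] {n d : ℕ} (c : Fin n → Y → ℝ)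
    (hc : ∀ i, Continuous (c i)) (g : (Fin n → unitInterval) → Y) (hg : Continuous g)
    (hcg : ∀ x i, c i (g x) = x i) (h : CovDimLE Y d) : n ≤ d := by
  let U : (Fin n → Bool) → Set Y := fun b => {y | ∀ i, if b i then c i y < 1 else 0 < c i y}
  have hU : ∀ b, IsOpen (U b) := by
    intro b
    simp only [U, Set.ofPred_forall]
    refine isOpen_iInter_of_finite fun i => ?_
    by_cases hb : b i
    · simpa [hb] using isOpen_lt (hc i) continuous_const
    · simpa [hb] using isOpen_lt continuous_const (hc i)
  have hUcov : (⋃ b, U b) = Set.univ := by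
    refine Set.eq_univ_of_forall fun y => Set.mem_iUnion.2 ⟨fun i => decide (c i y < 1), ?_⟩
    intro i
    by_cases hi : c i y < 1
    · simp [hi]
    · simpa [hi] using zero_lt_one.trans_le (not_lt.1 hi)
  obtain ⟨κ, W, hW, hWcov, hWU, hcard⟩ := h _ U hU hUcov
  obtain ⟨δ, hδ, hball⟩ := lebesgue_number_lemma_of_metric (s := Set.univ)
    (c := fun k => g ⁻¹' W k) isCompact_univ (fun k => (hW k).preimage hg) (by
      rw [← Set.preimage_iUnion, hWcov, Set.preimage_univ])
  choose φ hφ using fun x => hball x (Set.mem_univ x)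
  obtain ⟨N, hN⟩ := exists_nat_one_div_lt hδ
  let pt : (Fin n → ℤ) → Fin n → unitInterval :=
    fun p i => Set.projIcc (0 : ℝ) 1 zero_le_one (p i / (N + 1 : ℕ))
  have hself : ∀ x, g x ∈ W (φ x) := fun x => hφ x (Metric.mem_ball_self hδ)
  obtain ⟨v, τ, hinj⟩ := KuhnGrid.exists_simplex_injective (N := N + 1) N.succ_ne_zero
    (fun p => φ (pt p)) (fun i => {k | ∃ x, x i = 0 ∧ g x ∈ W k})
    (by
      intro i p hp
      refine ⟨pt p, ?_, hself _⟩
      simp [pt, hp, Set.projIcc_left])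
    (by
      rintro i p hp ⟨x, hx, hxW⟩
      obtain ⟨b, hb⟩ := hWU (φ (pt p))
      have h0 := hb hxW i
      have h1 := hb (hself (pt p)) i
      have hpt : pt p i = 1 := by
        have : ((p i : ℝ) / (N + 1 : ℕ)) = 1 := by
          rw [hp]; push_cast; exact div_self (by positivity)
        simp only [pt, this, Set.projIcc_right]
        rfl
      rw [hcg, hx] at h0
      rw [hcg, hpt] at h1
      by_cases hbi : b i <;> simp [hbi] at h0 h1)
  have hclose : ∀ k l, dist (pt (KuhnGrid.vertex v τ k)) (pt (KuhnGrid.vertex v τ l)) < δ := by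
    intro k l
    refine (dist_pi_lt_iff hδ).2 fun i => ?_
    refine lt_of_le_of_lt ?_ hN
    refine ((LipschitzWith.projIcc zero_le_one).dist_le_mul _ _).trans ?_
    rw [NNReal.coe_one, one_mul, Real.dist_eq, ← sub_div, abs_div, Nat.abs_cast]
    push_cast
    gcongr
    simp only [KuhnGrid.vertex]
    split_ifs <;> simp
  have hmem := hcard (g (pt (KuhnGrid.vertex v τ 0)))
    (Finset.univ.map ⟨_, hinj⟩) (by
      intro k hk
      obtain ⟨l, -, rfl⟩ := Finset.mem_map.1 hk
      exact hφ _ (hclose 0 l))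
  simpa using hmem

theorem covDimLE_of_isEmbedding {Y : Type} [TopologicalSpace Y] [CompactSpace Y] {n : ℕ}
    (f : Y → Fin n → ℝ) (hf : Topology.IsEmbedding f) : CovDimLE Y n := by
  intro ι U hU hUcov
  choose V hV hVU using fun i => hf.isInducing.isOpen_iff.1 (hU i)
  obtain ⟨δ, hδ, hball⟩ := lebesgue_number_lemma_of_metric (isCompact_range hf.continuous) hV (by
    rintro _ ⟨y, rfl⟩
    obtain ⟨i, hi⟩ := Set.mem_iUnion.1 (hUcov.ge (Set.mem_univ y))
    rw [← hVU i] at hi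
    exact Set.mem_iUnion.2 ⟨i, hi⟩)
  obtain ⟨N, hN⟩ := exists_nat_one_div_lt hδ
  let t : Y → Fin (n + 1) → Fin n → ℝ := fun y j i => (N + 1) * f y i - j / (n + 1)
  have ht : ∀ j i, Continuous fun y => t y j i := fun j i =>
    (continuous_const.mul ((continuous_apply i).comp hf.continuous)).sub continuous_const
  let W : Fin (n + 1) × (Fin n → ℤ) → Set Y :=
    fun k => {y | ∀ i, (k.2 i : ℝ) < t y k.1 i ∧ t y k.1 i < k.2 i + 1}
  have hfloor : ∀ {k y}, y ∈ W k → ∀ i, k.2 i = ⌊t y k.1 i⌋ := fun hy i =>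
    (Int.floor_eq_iff.2 ⟨(hy i).1.le, (hy i).2⟩).symm
  refine ⟨{k // (W k).Nonempty}, fun k => W k, ?_, ?_, ?_, ?_⟩
  · intro k
    simp only [W, Set.ofPred_forall]
    exact isOpen_iInter_of_finite fun i =>
      (isOpen_lt continuous_const (ht _ i)).inter (isOpen_lt (ht _ i) continuous_const)
  · refine Set.eq_univ_of_forall fun y => ?_
    obtain ⟨j, hj⟩ : ∃ j, ∀ i, ∀ m : ℤ, t y j i ≠ m := by
      by_contra! hcon
      choose a m ham using hcon
      obtain ⟨j, l, hjl, haj⟩ := Fintype.exists_ne_map_eq_of_card_lt a (by simp)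
      have hj := ham j
      have hl := ham l
      rw [haj] at hj
      have hn : (n + 1 : ℝ) ≠ 0 := by positivity
      have hreal : ((j : ℕ) : ℝ) - (l : ℕ) = (n + 1) * (m l - m j) := by
        rw [← hj, ← hl]
        simp only [t]
        field_simp
        ring
      have hint : ((j : ℕ) : ℤ) - (l : ℕ) = (n + 1) * (m l - m j) := by exact_mod_cast hreal
      have hj' := j.is_lt
      have hl' := l.is_lt
      have hzero : ((j : ℕ) : ℤ) - (l : ℕ) = 0 := by
        refine Int.eq_zero_of_abs_lt_dvd (m := n + 1) ⟨_, hint⟩ ?_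
        rw [abs_lt]
        omega
      exact hjl (Fin.ext (by omega))
    have hy : y ∈ W (j, fun i => ⌊t y j i⌋) := fun i =>
      ⟨lt_of_le_of_ne (Int.floor_le _) (hj i _).symm, Int.lt_floor_add_one _⟩
    exact Set.mem_iUnion.2 ⟨⟨_, y, hy⟩, hy⟩
  · rintro ⟨k, y, hy⟩
    obtain ⟨i, hi⟩ := hball (f y) ⟨y, rfl⟩
    refine ⟨i, fun z hz => ?_⟩
    rw [← hVU i]
    refine hi ((dist_pi_lt_iff hδ).2 fun a => lt_of_le_of_lt ?_ hN)
    have hy' := hy a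
    have hz' := hz a
    simp only [t] at hy' hz'
    rw [Real.dist_eq, le_div_iff₀ (by positivity), ← abs_of_pos (by positivity : (0 : ℝ) < N + 1),
      ← abs_mul, abs_le]
    constructor <;> nlinarith
  · intro y s hs
    have : s.card ≤ (Finset.univ : Finset (Fin (n + 1))).card := by
      refine Finset.card_le_card_of_injOn (fun k => k.1.1) (fun _ _ => Finset.mem_univ _) ?_
      intro k hk l hl hkl
      refine Subtype.ext (Prod.ext hkl (funext fun i => ?_))
      have hkl' : k.1.1 = l.1.1 := hkl
      rw [hfloor (hs k hk) i, hfloor (hs l hl) i, hkl']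
    simpa using this

theorem eq_apply_emod_of_periodic {n : ℕ} {x : ℤ → ℝ} (hx : ∀ m : ℤ, x (m + n) = x m) (m : ℤ) :
    x (m % n) = x m := by
  have hp : Function.Periodic x (n : ℤ) := hx
  conv_rhs => rw [← Int.emod_add_mul_ediv m n, mul_comm]
  exact ((hp.int_mul (m / n)) _).symm

theorem Fset_subset_XnSet {n : ℕ} (hn : 1 ≤ n) : Fset n ⊆ XnSet n := fun _ hx =>
  ⟨Set.mem_biUnion (show n ∈ {n : ℕ | 1 ≤ n} from hn) hx, hx.2⟩

theorem XnSet_eq_biUnion {n : ℕ} (hn : 1 ≤ n) :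
    XnSet n = ⋃ d ∈ Finset.Icc 1 n, Fset d ∩ {x | ∀ m : ℤ, x (m + n) = x m} := by
  ext x
  simp only [Set.mem_iUnion, Finset.mem_Icc, exists_prop]
  constructor
  · rintro ⟨hx, hxn⟩
    obtain ⟨k, hk, hxk, hxp⟩ := Set.mem_iUnion₂.1 hx
    have hk' : 0 < k := hk
    have hpos : 0 < Nat.gcd k n := Nat.gcd_pos_of_pos_left _ hk'
    refine ⟨Nat.gcd k n, ⟨hpos, Nat.gcd_le_right _ hn⟩, ⟨fun m => ⟨(hxk m).1, ?_⟩, ?_⟩, hxn⟩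
    · refine (hxk m).2.trans (one_div_le_one_div_of_le (by exact_mod_cast hpos) ?_)
      exact_mod_cast Nat.gcd_le_left n hk'
    · have h1 : Function.Periodic x (k : ℤ) := hxp
      have h2 : Function.Periodic x (n : ℤ) := hxn
      have h3 := (h1.int_mul (Nat.gcdA k n)).add_period (h2.int_mul (Nat.gcdB k n))
      rw [mul_comm, mul_comm _ (n : ℤ), Int.cast_id, Int.cast_id, ← Nat.gcd_eq_gcd_ab] at h3
      exact h3
  · rintro ⟨d, ⟨hd, -⟩, hx, hxn⟩
    exact ⟨Set.mem_biUnion (show d ∈ {n : ℕ | 1 ≤ n} from hd) hx, hxn⟩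

theorem isClosed_setOf_periodic (n : ℕ) : IsClosed {x : ℤ → ℝ | ∀ m : ℤ, x (m + n) = x m} := by
  simp only [Set.ofPred_forall]
  exact isClosed_iInter fun m => isClosed_eq (continuous_apply _) (continuous_apply _)

theorem isCompact_Fset (n : ℕ) : IsCompact (Fset n) := by
  have : Fset n = (Set.univ.pi fun _ => Set.Icc (0 : ℝ) (1 / n)) ∩
      {x | ∀ m : ℤ, x (m + n) = x m} := by
    ext x
    simp only [Fset, Set.mem_inter_iff, Set.mem_univ_pi]
    rfl
  rw [this]
  exact (isCompact_univ_pi fun _ => isCompact_Icc).inter_right (isClosed_setOf_periodic n)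

theorem isCompact_XnSet {n : ℕ} (hn : 1 ≤ n) : IsCompact (XnSet n) := by
  rw [XnSet_eq_biUnion hn]
  exact Finset.isCompact_biUnion _ fun d _ =>
    (isCompact_Fset d).inter_right (isClosed_setOf_periodic n)

theorem covDimLE_XnSet {n : ℕ} (hn : 1 ≤ n) : CovDimLE (XnSet n) n := by
  have : CompactSpace (XnSet n) := isCompact_iff_compactSpace.1 (isCompact_XnSet hn)
  have hn' : (0 : ℤ) < n := by exact_mod_cast hn
  have hcont : Continuous fun (x : XnSet n) (i : Fin n) => x.1 (i : ℕ) :=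
    continuous_pi fun i => (continuous_apply _).comp continuous_subtype_val
  refine covDimLE_of_isEmbedding _ (hcont.isClosedEmbedding ?_).isEmbedding
  intro x y hxy
  refine Subtype.ext (funext fun m => ?_)
  rw [← eq_apply_emod_of_periodic x.2.2, ← eq_apply_emod_of_periodic y.2.2]
  have h0 := Int.emod_nonneg m hn'.ne'
  have hlt := Int.emod_lt_of_pos m hn'
  have := congrFun hxy ⟨(m % n).toNat, by omega⟩
  simpa [Int.toNat_of_nonneg h0] using this

theorem le_of_covDimLE_XnSet {n d : ℕ} (hn : 1 ≤ n) (h : CovDimLE (XnSet n) d) : n ≤ d := by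
  have hn' : (0 : ℤ) < n := by exact_mod_cast hn
  have hn0 : (n : ℝ) ≠ 0 := by positivity
  have hlt : ∀ m : ℤ, (m % n).toNat < n := fun m => by
    have h0 := Int.emod_nonneg m hn'.ne'
    have hlt := Int.emod_lt_of_pos m hn'
    omega
  let ext : (Fin n → unitInterval) → ℤ → ℝ := fun x m => x ⟨(m % n).toNat, hlt m⟩ / n
  have hext : ∀ x, ext x ∈ XnSet n := fun x => Fset_subset_XnSet hn
    ⟨fun m => ⟨div_nonneg (x _).2.1 n.cast_nonneg,
      div_le_div_of_nonneg_right (x _).2.2 n.cast_nonneg⟩, fun m => by simp [ext]⟩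
  have hcont : ∀ i : Fin n, Continuous fun y : XnSet n => (n : ℝ) * y.1 (i : ℕ) := fun i =>
    continuous_const.mul ((continuous_apply ((i : ℕ) : ℤ)).comp continuous_subtype_val)
  refine le_of_covDimLE_of_cube (fun i y => n * y.1 (i : ℕ)) hcont
    (fun x => ⟨ext x, hext x⟩) (Continuous.subtype_mk (by fun_prop) _) (fun x i => ?_) h
  have hi : ((i : ℕ) : ℤ) % n = (i : ℕ) := Int.emod_eq_of_lt (by omega) (by omega)
  simp only [ext, hi, Int.toNat_natCast, Fin.eta]
  field_simp

theorem covDim_XnSet {n : ℕ} (hn : 1 ≤ n) : covDim (XnSet n) = n :=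
  le_antisymm (Nat.sInf_le (covDimLE_XnSet hn))
    (le_csInf ⟨n, covDimLE_XnSet hn⟩ fun _ h => le_of_covDimLE_XnSet hn h)

/-- `F_n ⊆ X_n` and `dim X_n = n` for each `n ≥ 1`, hence the
residual dimension `resdim(X : {nℤ}) = liminf_n dim X_n / n` equals `1`. -/
theorem stmt_15 :
    (∀ n : ℕ, 1 ≤ n → Fset n ⊆ XnSet n ∧ covDim (↥(XnSet n)) = n) ∧
      liminf (fun n : ℕ => (covDim (↥(XnSet n)) : ℝ≥0∞) / (n : ℝ≥0∞)) atTop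
        = 1 := by
  refine ⟨fun n hn => ⟨Fset_subset_XnSet hn, covDim_XnSet hn⟩, ?_⟩
  refine (tendsto_const_nhds.congr' ?_).liminf_eq
  filter_upwards [eventually_ge_atTop 1] with n hn
  rw [covDim_XnSet hn, ENNReal.div_self (by exact_mod_cast (show n ≠ 0 by omega))
    (ENNReal.natCast_ne_top n)]
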